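/- Let H = (A, φ, w, Ψ) be an HD0L-system, where A is a finite alphabet, φ: A* → A* is a non-erasing morphism, w ∈ A*, and Ψ: A* → B* is a morphism to words over a finite alphabet B. Then the set of primitive words v ∈ B* such that v^k belongs to the language L_H for every k ∈ ℕ is finite. -/

import Mathlib

/-- The extension of the morphism given by `φ` on letters to a morphism on words. -/
def extM {A B : Type*} (φ : A → List B) (w : List A) : List B := w.flatMap φ

/-- The `k`-th power `u^k` of a word `u`. -/
def wpow {A : Type*} (u : List A) (k : ℕ) : List A := (List.replicate k u).flatten

/-- A word `v` is primitive if `v = u^k` implies `k = 1`. -/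
def Primitive {A : Type*} (v : List A) : Prop :=
  v ≠ [] ∧ ∀ (u : List A) (k : ℕ), v = wpow u k → k = 1

/-- The language of the D0L-system `(A, φ, w)`: all factors of the words `φ^n(w)`. -/
def LangD0L {A : Type*} (φ : A → List A) (w : List A) : Set (List A) :=
  {v | ∃ n : ℕ, v <:+: (extM φ)^[n] w}

/-- `fact(Ψ(L))`: all factors of `Ψ`-images of elements of `L`. -/
def factImg {A B : Type*} (Ψ : A → List B) (L : Set (List A)) : Set (List B) :=
  {v | ∃ u ∈ L, v <:+: extM Ψ u}

/-- The language of the HD0L-system `(A, φ, w, Ψ)`. -/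
def LangHD0L {A B : Type*} (φ : A → List A) (w : List A) (Ψ : A → List B) : Set (List B) :=
  factImg Ψ (LangD0L φ w)

/-- A morphism is non-erasing if no letter is mapped to the empty word. -/
def NonErasing {A B : Type*} (φ : A → List B) : Prop := ∀ a, φ a ≠ []

/-- A letter `b` is bounded (w.r.t. `φ`) if the lengths `|φ^n(b)|` are bounded. -/
def BddLetter {A : Type*} (φ : A → List A) (b : A) : Prop :=
  ∃ C : ℕ, ∀ n : ℕ, ((extM φ)^[n] [b]).length ≤ C

/-- The set of letters occurring in a word. -/
def alph {A : Type*} (u : List A) : Set A := {a | a ∈ u}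

/-- `alph(φ(S))` for a set of letters `S`: letters occurring in `φ(b)` for some `b ∈ S`. -/
def alphIm {A : Type*} (φ : A → List A) (S : Set A) : Set A := ⋃ b ∈ S, alph (φ b)

/-- A D0L-system is pushy if its language contains infinitely many words over bounded letters. -/
def Pushy {A : Type*} (φ : A → List A) (w : List A) : Prop :=
  {v ∈ LangD0L φ w | ∀ a ∈ v, BddLetter φ a}.Infinite

/-- A factorial language `L` is uniformly recurrent: for every `n` there is `K` such that
every element of `L` of length `K` contains every element of `L` of length `n` as a factor. -/
def UnifRec {A : Type*} (L : Set (List A)) : Prop :=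
  ∀ n : ℕ, ∃ K : ℕ, ∀ u ∈ L, u.length = K → ∀ v ∈ L, v.length = n → v <:+: u

/-- Vertices of the tree of invariant subalphabets of `φ`: nonempty sets `S` with
`alph(φ(S)) = S` containing an unbounded letter `a` with `alph(φ(a)) = S`. -/
def IsVertex {A : Type*} (φ : A → List A) (S : Set A) : Prop :=
  S.Nonempty ∧ alphIm φ S = S ∧ ∃ a ∈ S, ¬ BddLetter φ a ∧ alph (φ a) = S

/-- Leaves of the tree of invariant subalphabets: minimal vertices w.r.t. inclusion. -/
def IsLeaf {A : Type*} (φ : A → List A) (S : Set A) : Prop :=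
  IsVertex φ S ∧ ∀ T, IsVertex φ T → T ⊆ S → T = S

/-- Two words are conjugate: `u = xy` and `v = yx`. -/
def Conj {A : Type*} (u v : List A) : Prop := ∃ x y : List A, u = x ++ y ∧ v = y ++ x

/-- The prefix of length `n` of an infinite word. -/
def prefW {A : Type*} (w : ℕ → A) (n : ℕ) : List A := (List.range n).map w

section Basics

variable {A B C : Type*}

lemma extM_nil (φ : A → List B) : extM φ [] = [] := rfl

lemma extM_append (φ : A → List B) (x y : List A) : extM φ (x ++ y) = extM φ x ++ extM φ y := by
  simp [extM]

lemma extM_cons (φ : A → List B) (a : A) (y : List A) : extM φ (a :: y) = φ a ++ extM φ y := by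
  simp [extM]

lemma extM_single (φ : A → List B) (a : A) : extM φ [a] = φ a := by
  simp [extM]

lemma mem_extM {φ : A → List B} {x : List A} {b : B} : b ∈ extM φ x ↔ ∃ a ∈ x, b ∈ φ a := by
  simp [extM]

lemma extM_infix (φ : A → List B) {x y : List A} (h : x <:+: y) : extM φ x <:+: extM φ y := by
  obtain ⟨s, t, rfl⟩ := h
  exact ⟨extM φ s, extM φ t, by simp [extM_append]⟩

lemma extM_comp (φ : A → List B) (ψ : B → List C) (x : List A) :
    extM ψ (extM φ x) = extM (fun a => extM ψ (φ a)) x := by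
  induction x with
  | nil => rfl
  | cons a x ih => rw [extM_cons, extM_append, ih, extM_cons]

lemma iter_append (φ : A → List A) (n : ℕ) (x y : List A) :
    (extM φ)^[n] (x ++ y) = (extM φ)^[n] x ++ (extM φ)^[n] y := by
  induction n generalizing x y with
  | zero => rfl
  | succ n ih => simp [Function.iterate_succ_apply, extM_append, ih]

lemma iter_nil (φ : A → List A) (n : ℕ) : (extM φ)^[n] [] = [] := by
  induction n with
  | zero => rfl
  | succ n ih => rw [Function.iterate_succ_apply, extM_nil, ih]

/-- The letter map of the power of a morphism. -/
def iterM (φ : A → List A) (n : ℕ) : A → List A := fun a => (extM φ)^[n] [a]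

lemma extM_iterM (φ : A → List A) (n : ℕ) (x : List A) :
    extM (iterM φ n) x = (extM φ)^[n] x := by
  induction x with
  | nil => rw [extM_nil, iter_nil]
  | cons a x ih =>
    rw [extM_cons, ih, iterM, ← iter_append]; rfl

lemma extM_iterM_fun (φ : A → List A) (n : ℕ) : extM (iterM φ n) = (extM φ)^[n] :=
  funext (extM_iterM φ n)

lemma iter_infix (φ : A → List A) (n : ℕ) {x y : List A} (h : x <:+: y) :
    (extM φ)^[n] x <:+: (extM φ)^[n] y := by
  rw [← extM_iterM, ← extM_iterM]; exact extM_infix _ h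

lemma length_extM_le (φ : A → List B) (M : ℕ) (x : List A) (h : ∀ a ∈ x, (φ a).length ≤ M) :
    (extM φ x).length ≤ x.length * M := by
  induction x with
  | nil => simp [extM_nil]
  | cons a x ih =>
    rw [extM_cons, List.length_append, List.length_cons]
    have := h a (by simp)
    have := ih (fun b hb => h b (by simp [hb]))
    nlinarith

lemma le_length_extM (φ : A → List B) (hφ : NonErasing φ) (x : List A) :
    x.length ≤ (extM φ x).length := by
  induction x with
  | nil => simp
  | cons a x ih =>
    rw [extM_cons, List.length_append, List.length_cons]
    have := List.length_pos_of_ne_nil (hφ a)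
    omega

lemma wpow_zero (u : List A) : wpow u 0 = [] := rfl

lemma wpow_add (u : List A) (m n : ℕ) : wpow u (m + n) = wpow u m ++ wpow u n := by
  rw [wpow, List.replicate_add, List.flatten_append]; rfl

lemma wpow_one (u : List A) : wpow u 1 = u := by simp [wpow]

lemma wpow_succ (u : List A) (n : ℕ) : wpow u (n + 1) = u ++ wpow u n := by
  rw [add_comm, wpow_add, wpow_one]

lemma wpow_succ' (u : List A) (n : ℕ) : wpow u (n + 1) = wpow u n ++ u := by
  rw [wpow_add, wpow_one]

lemma length_wpow (u : List A) (n : ℕ) : (wpow u n).length = n * u.length := by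
  simp [wpow]

lemma extM_wpow (φ : A → List B) (u : List A) (n : ℕ) :
    extM φ (wpow u n) = wpow (extM φ u) n := by
  induction n with
  | zero => rfl
  | succ n ih => rw [wpow_succ, wpow_succ, extM_append, ih]

lemma wpow_infix_wpow (u : List A) {m n : ℕ} (h : m ≤ n) : wpow u m <:+: wpow u n := by
  obtain ⟨k, rfl⟩ := Nat.exists_eq_add_of_le h
  rw [wpow_add]; exact List.infix_append_left

lemma wpow_hasPeriod (v : List A) (k : ℕ) : (wpow v k).HasPeriod v.length := by
  cases k with
  | zero => simp [wpow_zero, List.HasPeriod]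
  | succ k =>
    unfold List.HasPeriod
    conv_rhs => rw [wpow_succ]
    rw [List.take_left, ← wpow_succ, ← wpow_succ]
    exact ⟨v, (wpow_succ' _ _).symm⟩

lemma eq_wpow_of_hasPeriod {g : ℕ} (m : ℕ) : ∀ (v : List A),
    v.HasPeriod g → v.length = m * g → v = wpow (v.take g) m := by
  induction m with
  | zero => intro v _ h; simpa [wpow_zero] using h
  | succ m ih =>
    intro v hv hl
    have hpre := hv.drop_prefix
    have hdl : (v.drop g).length = m * g := by
      rw [List.length_drop, hl, Nat.succ_mul]; omega
    have hd := ih (v.drop g) (hv.infix (List.drop_suffix g v).isInfix) hdl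
    rw [wpow_succ]
    rcases Nat.eq_zero_or_pos m with rfl | hm
    · rw [wpow_zero, List.append_nil, List.take_of_length_le (by omega)]
    · have h1 : (v.drop g).take g = v.take g := by
        have h2 : (v.drop g).take g <+: v := (List.take_prefix _ _).trans hpre
        have h3 : v.take g <+: v := List.take_prefix _ _
        have hle : g ≤ m * g := Nat.le_mul_of_pos_left g hm
        have h4 := List.prefix_of_prefix_length_le h2 h3 (by simp)
        refine h4.eq_of_length ?_
        simp only [List.length_take, hdl, hl, Nat.succ_mul]; omega
      rw [h1] at hd
      rw [← hd, List.take_append_drop]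

/-- `u` is a factor of some power of `v`. -/
def InW (v u : List A) : Prop := ∃ k, u <:+: wpow v k

lemma InW.mono {v u u' : List A} (h : InW v u) (h' : u' <:+: u) : InW v u' :=
  ⟨h.choose, h'.trans h.choose_spec⟩

lemma root_infix {v : List A} (hv : v ≠ []) (k : ℕ) : ∀ (s u t : List A),
    s ++ u ++ t = wpow v k → 2 * v.length ≤ u.length → v <:+: u := by
  have hpos := List.length_pos_of_ne_nil hv
  induction k with
  | zero =>
    intro s u t h hl
    rw [wpow_zero] at h
    have := congrArg List.length h
    simp at this
    have hu : u = [] := this.2.1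
    rw [hu, List.length_nil] at hl
    omega
  | succ k ih =>
    intro s u t h hl
    rw [wpow_succ, List.append_assoc] at h
    rcases List.append_eq_append_iff.mp h with ⟨s1, h1, h2⟩ | ⟨s', h1, h2⟩
    · -- v = s ++ s1
      have hs1 : s1.length ≤ v.length := by rw [h1]; simp
      rcases List.append_eq_append_iff.mp h2 with ⟨as, h3, h4⟩ | ⟨u1, h3, h4⟩
      · have := congrArg List.length h3
        simp at this; omega
      · have hk : 0 < k := by
          rcases Nat.eq_zero_or_pos k with rfl | hk
          · have := congrArg List.length h4
            have := congrArg List.length h3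
            simp [wpow_zero] at *; omega
          · exact hk
        obtain ⟨k, rfl⟩ := Nat.exists_eq_succ_of_ne_zero hk.ne'
        rw [Nat.succ_eq_add_one, wpow_succ] at h4
        have h5 : v <+: u1 ++ t := ⟨_, h4⟩
        have h6 : u1 <+: u1 ++ t := ⟨_, rfl⟩
        have h7 : v.length ≤ u1.length := by
          have := congrArg List.length h3
          simp at this; omega
        have h8 := List.prefix_of_prefix_length_le h5 h6 h7
        rw [h3]
        exact h8.isInfix.trans (List.infix_append_right)
    · exact ih s' u t (by rw [h2, List.append_assoc]) hl

lemma length_dvd {v p u : List A} (hv : Primitive v) (hu : InW v u) (hp : InW p u)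
    (hl : 2 * v.length + p.length ≤ u.length) : v.length ∣ p.length := by
  obtain ⟨k, hk⟩ := hu
  obtain ⟨m, hm⟩ := hp
  have h1 := (wpow_hasPeriod v k).infix hk
  have h2 := (wpow_hasPeriod p m).infix hm
  have h3 := h1.gcd h2 (by omega)
  obtain ⟨s, t, hst⟩ := hk
  have h4 := h3.infix (root_infix hv.1 k s u t hst (by omega))
  have hpos := List.length_pos_of_ne_nil hv.1
  have hg := Nat.gcd_pos_of_pos_left p.length hpos
  obtain ⟨c, hc⟩ := Nat.gcd_dvd_left v.length p.length
  have h5 := eq_wpow_of_hasPeriod c v h4 (by rw [mul_comm]; exact hc)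
  have h6 := hv.2 _ _ h5
  subst h6
  rw [mul_one] at hc
  rw [hc]; exact Nat.gcd_dvd_right _ _

/-- If a family of words with unbounded lengths is fixed, only finitely many primitive words have
powers containing the whole family. -/
lemma finite_family [Finite A] (F : ℕ → List A) (hF : ∀ C, ∃ j, C ≤ (F j).length) :
    {v : List A | Primitive v ∧ ∀ j, InW v (F j)}.Finite := by
  rcases Set.eq_empty_or_nonempty {v : List A | Primitive v ∧ ∀ j, InW v (F j)} with h | ⟨v0, h0⟩
  · rw [h]; exact Set.finite_empty
  · refine (List.finite_length_le A v0.length).subset ?_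
    intro v hv
    obtain ⟨j, hj⟩ := hF (2 * v.length + v0.length)
    exact Nat.le_of_dvd (List.length_pos_of_ne_nil h0.1.1) (length_dvd hv.1 (hv.2 j) (h0.2 j) hj)

/-- Arbitrarily large powers of `v` are factors of words from `S`. -/
def BigRep (v : List A) (S : Set (List A)) : Prop := ∀ k, ∃ s ∈ S, wpow v k <:+: s

lemma infix_split {x y s t : List A} (h : x ++ y <:+: s ++ t) : x <:+: s ∨ y <:+: t := by
  obtain ⟨a, b, h⟩ := h
  have h' : (a ++ x) ++ (y ++ b) = s ++ t := by rw [← h]; simp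
  rcases List.append_eq_append_iff.mp h' with ⟨c, h1, h2⟩ | ⟨c, h1, h2⟩
  · left; exact ⟨a, c, h1.symm⟩
  · right; exact ⟨c, b, by rw [h2]; simp⟩

lemma not_wpow_infix {v x : List A} (hv : v ≠ []) {K : ℕ} (hx : x.length < K) :
    ¬ wpow v K <:+: x := by
  intro h
  have h1 := h.length_le
  rw [length_wpow] at h1
  have := Nat.le_mul_of_pos_right K (List.length_pos_of_ne_nil hv)
  omega

lemma BigRep.of_pad {v : List A} (hv : v ≠ []) {S : Set (List A)} (K : ℕ)
    (h : ∀ k, ∃ x y z, wpow v k <:+: x ++ (y ++ z) ∧ x.length ≤ K ∧ z.length ≤ K ∧ y ∈ S) :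
    BigRep v S := by
  intro k
  obtain ⟨x, y, z, h1, hx, hz, hy⟩ := h ((K + 1) + (k + (K + 1)))
  rw [wpow_add v (K + 1), wpow_add v k] at h1
  refine ⟨y, hy, ?_⟩
  rcases infix_split h1 with h2 | h2
  · exact absurd h2 (not_wpow_infix hv (by omega))
  · rcases infix_split h2 with h3 | h3
    · exact h3
    · exact absurd h3 (not_wpow_infix hv (by omega))

lemma BigRep.exists_of_iUnion {v : List A} {ι : Type*} [Fintype ι] {S : Set (List A)}
    {T : ι → Set (List A)} (h : BigRep v S) (hST : ∀ s ∈ S, ∃ i, s ∈ T i) : ∃ i, BigRep v (T i) := by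
  by_contra hcon
  simp only [BigRep, not_exists, not_forall] at hcon
  choose k hk using hcon
  obtain ⟨s, hs, hks⟩ := h (∑ i, k i)
  obtain ⟨i, hi⟩ := hST s hs
  refine hk i s ⟨hi, ?_⟩
  exact (wpow_infix_wpow v (Finset.single_le_sum (f := k) (fun _ _ => Nat.zero_le _)
    (Finset.mem_univ i))).trans hks

lemma BigRep.or {v : List A} {T₁ T₂ : Set (List A)} (h : ∀ k, ∃ x y,
    x ∈ T₁ ∧ y ∈ T₂ ∧ (wpow v k <:+: x ∨ wpow v k <:+: y)) : BigRep v T₁ ∨ BigRep v T₂ := by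
  by_contra hcon
  simp only [BigRep, not_or, not_forall, not_exists] at hcon
  obtain ⟨⟨k1, h1⟩, ⟨k2, h2⟩⟩ := hcon
  obtain ⟨x, y, hx, hy, h | h⟩ := h (k1 + k2)
  · exact h1 x ⟨hx, (wpow_infix_wpow v (by omega)).trans h⟩
  · exact h2 y ⟨hy, (wpow_infix_wpow v (by omega)).trans h⟩

/-- Decomposition of a prefix of an image. -/
lemma prefix_extM (θ : A → List B) (u : List A) : ∀ p, p <+: extM θ u →
    ∃ g q, p = extM θ g ++ q ∧ g <+: u ∧ (q = [] ∨ ∃ c ∈ u, q <+: θ c) := by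
  induction u with
  | nil =>
    intro p hp
    rw [extM_nil] at hp
    exact ⟨[], [], by simpa [extM_nil] using hp, by simp, Or.inl rfl⟩
  | cons a u ih =>
    intro p hp
    rw [extM_cons] at hp
    obtain ⟨t, ht⟩ := hp
    rcases List.append_eq_append_iff.mp ht with ⟨c, h1, h2⟩ | ⟨c, h1, h2⟩
    · exact ⟨[], p, by simp [extM_nil], by simp, Or.inr ⟨a, by simp, ⟨c, h1.symm⟩⟩⟩
    · obtain ⟨g, q, h3, h4, h5⟩ := ih c ⟨t, h2.symm⟩
      refine ⟨a :: g, q, by rw [h1, h3, extM_cons, List.append_assoc], ?_, ?_⟩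
      · simpa using h4
      · rcases h5 with h5 | ⟨c, hc, h5⟩
        · exact Or.inl h5
        · exact Or.inr ⟨c, by simp [hc], h5⟩

/-- Decomposition of a factor of an image. -/
lemma infix_extM (θ : A → List B) (u : List A) : ∀ s, s <:+: extM θ u →
    (∃ c ∈ u, s <:+: θ c) ∨ ∃ x g y, s = x ++ extM θ g ++ y ∧ g <:+: u ∧
      (x = [] ∨ ∃ c ∈ u, x <:+ θ c) ∧ (y = [] ∨ ∃ c ∈ u, y <+: θ c) := by
  induction u with
  | nil =>
    intro s hs
    rw [extM_nil] at hs
    right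
    exact ⟨[], [], [], by simpa [extM_nil] using hs, by simp, Or.inl rfl, Or.inl rfl⟩
  | cons a u ih =>
    intro s hs
    rw [extM_cons] at hs
    rcases List.infix_append_iff.mp hs with h | h | ⟨x, p, rfl, hx, hp⟩
    · left; exact ⟨a, by simp, h⟩
    · rcases ih s h with ⟨c, hc, h⟩ | ⟨x, g, y, h1, h2, h3, h4⟩
      · left; exact ⟨c, by simp [hc], h⟩
      · right
        refine ⟨x, g, y, h1, h2.trans (List.suffix_cons _ _).isInfix, ?_, ?_⟩
        · exact h3.imp id fun ⟨c, hc, h⟩ => ⟨c, by simp [hc], h⟩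
        · exact h4.imp id fun ⟨c, hc, h⟩ => ⟨c, by simp [hc], h⟩
    · right
      obtain ⟨g, q, h3, h4, h5⟩ := prefix_extM θ u p hp
      refine ⟨x, g, q, by rw [h3, List.append_assoc],
        h4.isInfix.trans (List.suffix_cons _ _).isInfix, Or.inr ⟨a, by simp, hx⟩, ?_⟩
      exact h5.imp id fun ⟨c, hc, h⟩ => ⟨c, by simp [hc], h⟩

end Basics

section CoreSection

variable {A B : Type*}

/-- All letters of the word are outside `U`. -/
def Bd (U : A → Prop) (x : List A) : Prop := ∀ b ∈ x, ¬ U b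

lemma Bd.infix {U : A → Prop} {x y : List A} (h : Bd U y) (hxy : x <:+: y) : Bd U x :=
  fun b hb => h b (hxy.subset hb)

/-- A normalized morphism: `U` plays the role of the set of unbounded letters. -/
structure Core (φ : A → List A) (U : A → Prop) : Prop where
  bdd : ∀ b, ¬ U b → Bd U (φ b)
  idem : ∀ b, ¬ U b → extM φ (φ b) = φ b
  right : ∀ a, U a → ∃ x d y, φ a = x ++ d :: y ∧ U d ∧ Bd U y ∧
    ∃ x' y', φ d = x' ++ d :: y' ∧ Bd U y'
  left : ∀ a, U a → ∃ x d y, φ a = x ++ d :: y ∧ U d ∧ Bd U x ∧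
    ∃ x' y', φ d = x' ++ d :: y' ∧ Bd U x'

def revM (φ : A → List A) : A → List A := fun a => (φ a).reverse

lemma extM_revM (φ : A → List A) (x : List A) :
    extM (revM φ) x.reverse = (extM φ x).reverse := by
  induction x with
  | nil => rfl
  | cons a x ih => rw [List.reverse_cons, extM_append, ih, extM_single, extM_cons,
      List.reverse_append]; rfl

lemma iter_revM (φ : A → List A) (n : ℕ) (x : List A) :
    (extM (revM φ))^[n] x.reverse = ((extM φ)^[n] x).reverse := by
  induction n generalizing x with
  | zero => rfl
  | succ n ih => rw [Function.iterate_succ_apply, extM_revM, ih, Function.iterate_succ_apply]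

lemma Core.rev {φ : A → List A} {U : A → Prop} (h : Core φ U) : Core (revM φ) U where
  bdd b hb c hc := h.bdd b hb c (by simpa [revM] using hc)
  idem b hb := by
    unfold revM
    rw [← h.idem b hb]
    have := extM_revM φ (φ b)
    unfold revM at this
    rw [h.idem b hb] at this ⊢
    exact this
  right a ha := by
    obtain ⟨x, d, y, h1, h2, h3, x', y', h4, h5⟩ := h.left a ha
    exact ⟨y.reverse, d, x.reverse, by simp [revM, h1], h2, fun b hb => h3 b (by simpa using hb),
      y'.reverse, x'.reverse, by simp [revM, h4], fun b hb => h5 b (by simpa using hb)⟩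
  left a ha := by
    obtain ⟨x, d, y, h1, h2, h3, x', y', h4, h5⟩ := h.right a ha
    exact ⟨y.reverse, d, x.reverse, by simp [revM, h1], h2, fun b hb => h3 b (by simpa using hb),
      y'.reverse, x'.reverse, by simp [revM, h4], fun b hb => h5 b (by simpa using hb)⟩

variable {φ : A → List A} {U : A → Prop}

lemma Core.bd_extM (h : Core φ U) {x : List A} (hx : Bd U x) : Bd U (extM φ x) := by
  intro b hb
  obtain ⟨a, ha, hb⟩ := mem_extM.mp hb
  exact h.bdd a (hx a ha) b hb

lemma Core.idem_extM (h : Core φ U) {x : List A} (hx : Bd U x) :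
    extM φ (extM φ x) = extM φ x := by
  induction x with
  | nil => rfl
  | cons a x ih =>
    rw [extM_cons, extM_append, ih (fun b hb => hx b (by simp [hb])), h.idem a (hx a (by simp))]

lemma Core.iter_succ (h : Core φ U) {x : List A} (hx : Bd U x) (n : ℕ) :
    (extM φ)^[n + 1] x = extM φ x := by
  induction n with
  | zero => rfl
  | succ n ih => rw [Function.iterate_succ_apply', ih, h.idem_extM hx]

lemma Core.length_iter (h : Core φ U) {x : List A} (hx : Bd U x) {M : ℕ} (hM : 1 ≤ M)
    (hφ : ∀ a, (φ a).length ≤ M) (n : ℕ) : ((extM φ)^[n] x).length ≤ x.length * M := by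
  cases n with
  | zero => exact Nat.le_mul_of_pos_right _ hM
  | succ n => rw [h.iter_succ hx]; exact length_extM_le φ M x (fun a _ => hφ a)

lemma Core.u_iter (h : Core φ U) {a : A} (ha : U a) (n : ℕ) :
    ∃ d ∈ (extM φ)^[n] [a], U d := by
  induction n with
  | zero => exact ⟨a, by simp, ha⟩
  | succ n ih =>
    obtain ⟨d, hd, hU⟩ := ih
    obtain ⟨x, e, y, h1, h2, -⟩ := h.right d hU
    refine ⟨e, ?_, h2⟩
    rw [Function.iterate_succ_apply']
    exact mem_extM.mpr ⟨d, hd, by simp [h1]⟩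

lemma Core.bd_of_iter (h : Core φ U) {x : List A} {n : ℕ} (hx : Bd U ((extM φ)^[n] x)) :
    Bd U x := by
  intro a ha hU
  obtain ⟨d, hd, hd'⟩ := h.u_iter hU n
  refine hx d ?_ hd'
  have : [a] <:+: x := by rwa [List.singleton_infix_iff]
  exact (iter_infix φ n this).subset hd

lemma bd_suffix {s X Y : List A} (hs : Bd U s) (h : s <:+ X ++ Y) (hY : ∃ e ∈ Y, U e) :
    s <:+ Y := by
  rcases List.suffix_or_suffix_of_suffix h (List.suffix_append X Y) with h | h
  · exact h
  · obtain ⟨e, he, hU⟩ := hY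
    exact absurd hU (hs e (h.subset he))

lemma suffix_append_cases {s X Y : List A} (h : s <:+ X ++ Y) :
    s <:+ Y ∨ ∃ s', s' <:+ X ∧ s = s' ++ Y := by
  obtain ⟨t, ht⟩ := h
  rcases List.append_eq_append_iff.mp ht with ⟨c, h1, h2⟩ | ⟨c, h1, h2⟩
  · exact Or.inr ⟨c, ⟨t, h1.symm⟩, h2⟩
  · exact Or.inl ⟨c, h2.symm⟩

lemma bd_suffix_single {s : List A} {d : A} (hd : U d) (hs : Bd U s) (h : s <:+ [d]) : s = [] := by
  rcases List.suffix_cons_iff.mp h with h | h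
  · exact absurd hd (hs d (by simp [h]))
  · simpa using h

lemma Core.suffix_fixed (h : Core φ U) {d : A} {x y : List A} (hd : U d)
    (hφd : φ d = x ++ d :: y) (hy : Bd U y) (m : ℕ) : ∀ s, Bd U s → s <:+ (extM φ)^[m + 1] [d] →
    s <:+ y ++ wpow (extM φ y) m := by
  have key : ∀ m s, Bd U s → s <:+ (extM φ)^[m + 1] [d] →
      s <:+ (extM φ)^[m] [d] ++ (extM φ)^[m] y := by
    intro m s hs h1
    rw [Function.iterate_succ_apply, extM_single, hφd, iter_append,
      show d :: y = [d] ++ y from rfl, iter_append] at h1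
    exact bd_suffix hs h1 (by
      obtain ⟨e, he, hU⟩ := h.u_iter hd m
      exact ⟨e, by simp [he], hU⟩)
  induction m with
  | zero =>
    intro s hs h1
    rw [wpow_zero, List.append_nil]
    rcases suffix_append_cases (key 0 s hs h1) with h3 | ⟨s', h3, h4⟩
    · exact h3
    · have h5 := bd_suffix_single hd (fun b hb => hs b (by simp [h4, hb])) h3
      rw [h4, h5]; exact List.suffix_refl _
  | succ m ih =>
    intro s hs h1
    have h2 := key (m + 1) s hs h1
    rw [h.iter_succ hy] at h2
    rw [wpow_succ']
    rcases suffix_append_cases h2 with h3 | ⟨s', h3, h4⟩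
    · rw [← List.append_assoc]; exact h3.trans (List.suffix_append _ _)
    · have h5 := ih s' (fun b hb => hs b (by simp [h4, hb])) h3
      obtain ⟨t, ht⟩ := h5
      refine ⟨t, ?_⟩
      rw [h4, ← List.append_assoc, ht, List.append_assoc]

lemma Core.suffix_shape (h : Core φ U) {M : ℕ} (hM : 1 ≤ M) (hφ : ∀ a, (φ a).length ≤ M)
    (c : A) (m : ℕ) (s : List A) (hs : Bd U s) (h1 : s <:+ (extM φ)^[m] [c]) :
    ∃ y p n z, s <:+: y ++ (wpow p n ++ z) ∧ y.length ≤ M * M ∧ z.length ≤ M * M ∧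
      p.length ≤ M * M ∧ extM φ p = p := by
  have short : s.length ≤ M * M → ∃ y p n z, s <:+: y ++ (wpow p n ++ z) ∧ y.length ≤ M * M ∧
      z.length ≤ M * M ∧ p.length ≤ M * M ∧ extM φ p = p := fun hl =>
    ⟨s, [], 0, [], by simp [wpow_zero], hl, by simp, by simp, rfl⟩
  have hMM : M ≤ M * M := Nat.le_mul_of_pos_right _ hM
  by_cases hc : U c
  · cases m with
    | zero =>
      refine short ?_
      have := h1.length_le
      simp at this
      omega
    | succ m =>
      obtain ⟨x, d, y, h2, hd, hy, x', y', h3, hy'⟩ := h.right c hc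
      rw [Function.iterate_succ_apply, extM_single, h2, iter_append,
        show d :: y = [d] ++ y from rfl, iter_append] at h1
      have h4 := bd_suffix hs h1 (by
        obtain ⟨e, he, hU⟩ := h.u_iter hd m
        exact ⟨e, by simp [he], hU⟩)
      have hyl : y.length ≤ M := by
        have := hφ c
        rw [h2] at this
        simp at this
        omega
      have hyl' : y'.length ≤ M := by
        have := hφ d
        rw [h3] at this
        simp at this
        omega
      have hz : ((extM φ)^[m] y).length ≤ M * M :=
        (h.length_iter hy hM hφ m).trans (Nat.mul_le_mul_right M hyl)
      rcases suffix_append_cases h4 with h5 | ⟨s', h5, h6⟩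
      · exact short (h5.length_le.trans hz)
      · have hs' : Bd U s' := fun b hb => hs b (by simp [h6, hb])
        cases m with
        | zero =>
          have h7 := bd_suffix_single hd hs' h5
          rw [h7] at h6
          refine short ?_
          rw [h6]; exact hz
        | succ m =>
          obtain ⟨t, ht⟩ := h.suffix_fixed hd h3 hy' m s' hs' h5
          refine ⟨y', extM φ y', m, (extM φ)^[m + 1] y, ⟨t, [], ?_⟩, hyl'.trans hMM, hz, ?_,
            h.idem_extM hy'⟩
          · rw [h6, List.append_nil, ← List.append_assoc, ht, List.append_assoc]
          · exact (length_extM_le φ M y' (fun a _ => hφ a)).trans (Nat.mul_le_mul_right M hyl')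
  · refine short ?_
    have hb : Bd U [c] := by
      intro b hb
      simp at hb
      rwa [hb]
    have := h.length_iter hb hM hφ m
    have := h1.length_le
    simp at *
    omega

lemma wpow_reverse (p : List A) (n : ℕ) : (wpow p n).reverse = wpow p.reverse n := by
  induction n with
  | zero => rfl
  | succ n ih => rw [wpow_succ, List.reverse_append, ih, wpow_succ']

lemma Core.prefix_shape (h : Core φ U) {M : ℕ} (hM : 1 ≤ M) (hφ : ∀ a, (φ a).length ≤ M)
    (c : A) (m : ℕ) (s : List A) (hs : Bd U s) (h1 : s <+: (extM φ)^[m] [c]) :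
    ∃ y p n z, s <:+: y ++ (wpow p n ++ z) ∧ y.length ≤ M * M ∧ z.length ≤ M * M ∧
      p.length ≤ M * M ∧ extM φ p = p := by
  obtain ⟨y, p, n, z, h2, h3, h4, h5, h6⟩ := h.rev.suffix_shape hM
    (fun a => by simpa [revM] using hφ a) c m s.reverse (fun b hb => hs b (by simpa using hb)) (by
      have := iter_revM φ m [c]
      rw [List.reverse_singleton] at this
      rw [this, List.reverse_suffix]
      exact h1)
  refine ⟨z.reverse, p.reverse, n, y.reverse, ?_, by simpa using h4, by simpa using h3,
    by simpa using h5, ?_⟩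
  · have := List.reverse_infix.mpr h2
    rw [List.reverse_reverse] at this
    simpa [wpow_reverse] using this
  · have := extM_revM φ p.reverse
    rw [List.reverse_reverse, h6] at this
    rw [← List.reverse_reverse (extM φ p.reverse), ← this]

lemma Core.bounded_factor (h : Core φ U) {M : ℕ} (hM : 1 ≤ M) (hφ : ∀ a, (φ a).length ≤ M)
    (n : ℕ) : ∀ z : List A, z.length ≤ M → ∀ u, Bd U u → u <:+: (extM φ)^[n] z →
    ∃ x g y, u = x ++ g ++ y ∧ g.length ≤ M * M ∧ (x = [] ∨ ∃ c m, x <:+ (extM φ)^[m] [c]) ∧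
      (y = [] ∨ ∃ c m, y <+: (extM φ)^[m] [c]) := by
  induction n with
  | zero =>
    intro z hz u hu h1
    refine ⟨[], u, [], by simp, ?_, Or.inl rfl, Or.inl rfl⟩
    have := h1.length_le
    have hMM : M ≤ M * M := Nat.le_mul_of_pos_right _ hM
    simp at this
    omega
  | succ n ih =>
    intro z hz u hu h1
    rw [← extM_iterM] at h1
    rcases infix_extM _ z u h1 with ⟨c, hc, h2⟩ | ⟨x, g, y, h2, h3, h4, h5⟩
    · unfold iterM at h2
      rw [Function.iterate_succ_apply, extM_single] at h2
      exact ih (φ c) (hφ c) u hu h2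
    · rw [extM_iterM] at h2
      refine ⟨x, (extM φ)^[n + 1] g, y, h2, ?_, ?_, ?_⟩
      · have hg : Bd U g := h.bd_of_iter (n := n + 1) (hu.infix ⟨x, y, h2.symm⟩)
        exact (h.length_iter hg hM hφ _).trans (Nat.mul_le_mul_right M (h3.length_le.trans hz))
      · exact h4.imp id fun ⟨c, _, hc⟩ => ⟨c, n + 1, hc⟩
      · exact h5.imp id fun ⟨c, _, hc⟩ => ⟨c, n + 1, hc⟩

lemma length_le_of_rep {v : List B} (hv : Primitive v) {L : ℕ}
    (h : BigRep v {s | ∃ p n, p.length ≤ L ∧ s = wpow p n}) : v.length ≤ L := by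
  have hpos := List.length_pos_of_ne_nil hv.1
  obtain ⟨s, ⟨p, n, hp, rfl⟩, h1⟩ := h (2 * v.length + L + 1)
  have hl : 2 * v.length + L + 1 ≤ (wpow v (2 * v.length + L + 1)).length := by
    rw [length_wpow]; exact Nat.le_mul_of_pos_right _ hpos
  have hp0 : 0 < p.length := by
    rcases Nat.eq_zero_or_pos p.length with h0 | h0
    · have := h1.length_le
      rw [length_wpow p, h0] at this
      omega
    · exact h0
  exact (Nat.le_of_dvd hp0 (length_dvd hv ⟨_, List.infix_refl _⟩ ⟨n, h1⟩ (by omega))).trans hp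

theorem core_finite [Fintype A] [Fintype B] (h : Core φ U) (w : List A) (Ψ : A → List B)
    (hunb : ∀ a, U a → ∀ C, ∃ j, C ≤ (extM Ψ ((extM φ)^[j] [a])).length) :
    {v : List B | Primitive v ∧ BigRep v (Set.range fun n => extM Ψ ((extM φ)^[n] w))}.Finite := by
  classical
  obtain ⟨M, hM, hφ, hΨ, hw⟩ : ∃ M, 1 ≤ M ∧ (∀ a, (φ a).length ≤ M) ∧ (∀ a, (Ψ a).length ≤ M) ∧
      w.length ≤ M := by
    refine ⟨1 + ∑ a, (φ a).length + ∑ a, (Ψ a).length + w.length, by omega, ?_, ?_, by omega⟩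
    · intro a
      have := Finset.single_le_sum (f := fun a => (φ a).length) (fun _ _ => Nat.zero_le _)
        (Finset.mem_univ a)
      omega
    · intro a
      have := Finset.single_le_sum (f := fun a => (Ψ a).length) (fun _ _ => Nat.zero_le _)
        (Finset.mem_univ a)
      omega
  have hfin1 : (⋃ d ∈ {d | U d}, {v : List B | Primitive v ∧
      ∀ j, InW v (extM Ψ ((extM φ)^[j] [d]))}).Finite := by
    refine Set.Finite.biUnion (Set.toFinite _) ?_
    intro d hd
    exact finite_family (fun j => extM Ψ ((extM φ)^[j] [d])) (hunb d hd)
  refine (hfin1.union (List.finite_length_le B (M * M * M))).subset ?_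
  rintro v ⟨hv, hrep⟩
  by_cases hi : ∀ J, ∃ c, U c ∧ InW v (extM Ψ ((extM φ)^[J] [c]))
  · left
    have hi' : ∀ J, ∃ d, U d ∧ d ∈ φ d ∧ InW v (extM Ψ ((extM φ)^[J] [d])) := by
      intro J
      obtain ⟨c, hc, h1⟩ := hi (J + 1)
      obtain ⟨x, d, y, h2, hd, hy, x', y', h3, hy'⟩ := h.right c hc
      refine ⟨d, hd, by simp [h3], h1.mono ?_⟩
      rw [Function.iterate_succ_apply, extM_single]
      refine extM_infix Ψ (iter_infix φ J ?_)
      rw [List.singleton_infix_iff, h2]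
      simp
    have hmono : ∀ d, d ∈ φ d → ∀ j k, (extM φ)^[j] [d] <:+: (extM φ)^[j + k] [d] := by
      intro d hd j k
      induction k with
      | zero => exact List.infix_refl _
      | succ k ih =>
        refine ih.trans ?_
        rw [← add_assoc, Function.iterate_succ_apply, extM_single]
        refine iter_infix φ _ ?_
        rwa [List.singleton_infix_iff]
    simp only [Set.mem_iUnion]
    by_contra hcon
    have hcon' : ∀ d, ∃ j, U d → ¬ InW v (extM Ψ ((extM φ)^[j] [d])) := by
      intro d
      by_contra hc
      push Not at hc
      exact hcon ⟨d, (hc 0).1, hv, fun j => (hc j).2⟩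
    choose j hj using hcon'
    obtain ⟨d, hd, hdd, h1⟩ := hi' (∑ d, j d)
    refine hj d hd (h1.mono (extM_infix Ψ ?_))
    obtain ⟨k, hk⟩ := Nat.exists_eq_add_of_le (Finset.single_le_sum (f := j)
      (fun _ _ => Nat.zero_le _) (Finset.mem_univ d))
    rw [hk]
    exact hmono d hdd _ _
  · right
    push Not at hi
    obtain ⟨J, hJ⟩ := hi
    set θ : A → List B := fun a => extM Ψ (iterM φ J a) with hθ
    have hθx : ∀ x, extM θ x = extM Ψ ((extM φ)^[J] x) := by
      intro x
      rw [← extM_iterM, extM_comp]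
    obtain ⟨K, hK1, hK⟩ : ∃ K, 1 ≤ K ∧ ∀ a, (θ a).length ≤ K := by
      refine ⟨1 + ∑ a, (θ a).length, by omega, fun a => ?_⟩
      have := Finset.single_le_sum (f := fun a => (θ a).length) (fun _ _ => Nat.zero_le _)
        (Finset.mem_univ a)
      omega
    have hθl : ∀ x : List A, x.length ≤ M * M → (extM θ x).length ≤ M * M * K := fun x hx =>
      (length_extM_le θ K x (fun a _ => hK a)).trans (Nat.mul_le_mul_right K hx)
    -- Step 1: cover by images of bounded factors
    have step1 : BigRep v {s | ∃ u n, Bd U u ∧ u <:+: (extM φ)^[n] w ∧ s = extM θ u} := by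
      refine BigRep.of_pad hv.1 K fun k => ?_
      set L := ∑ n ∈ Finset.range J, (extM Ψ ((extM φ)^[n] w)).length + 1 with hL
      obtain ⟨s, ⟨n, rfl⟩, h1⟩ := hrep (k + L)
      have hn : J ≤ n := by
        by_contra hlt
        have h2 := Finset.single_le_sum (f := fun n => (extM Ψ ((extM φ)^[n] w)).length)
          (fun _ _ => Nat.zero_le _) (Finset.mem_range.mpr (not_le.mp hlt))
        exact not_wpow_infix hv.1 (by simp only; omega) h1
      obtain ⟨q, rfl⟩ := Nat.exists_eq_add_of_le hn
      have h2 : wpow v k <:+: extM θ ((extM φ)^[q] w) := by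
        rw [hθx, ← Function.iterate_add_apply]
        exact (wpow_infix_wpow v (by omega)).trans h1
      rcases infix_extM θ _ _ h2 with ⟨c, hc, h3⟩ | ⟨x, g, y, h3, h4, h5, h6⟩
      · exact ⟨θ c, [], [], by simpa using h3, hK c, by simp, [], 0, by simp [Bd], by simp, rfl⟩
      · refine ⟨x, extM θ g, y, by rw [h3]; simp, ?_, ?_, g, q, ?_, h4, rfl⟩
        · rcases h5 with rfl | ⟨c, -, hc⟩
          · simp
          · exact hc.length_le.trans (hK c)
        · rcases h6 with rfl | ⟨c, -, hc⟩
          · simp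
          · exact hc.length_le.trans (hK c)
        · intro c hc hU
          refine hJ c hU ⟨k, ?_⟩
          rw [← hθx, h3]
          have : [c] <:+: g := by rwa [List.singleton_infix_iff]
          exact (extM_infix θ this).trans ⟨x, y, rfl⟩
    -- Step 2: split bounded factors
    have step2 : BigRep v {s | ∃ u, Bd U u ∧ (u = [] ∨ ∃ c m, u <:+ (extM φ)^[m] [c]) ∧
          s = extM θ u} ∨
        BigRep v {s | ∃ u, Bd U u ∧ (u = [] ∨ ∃ c m, u <+: (extM φ)^[m] [c]) ∧
          s = extM θ u} := by
      refine BigRep.or fun k => ?_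
      obtain ⟨s, ⟨u, n, hu, h1, rfl⟩, h2⟩ := step1 (k + ((M * M * K + 1) + k))
      obtain ⟨x, g, y, rfl, hg, hx, hy⟩ := h.bounded_factor hM hφ n w hw u hu h1
      refine ⟨extM θ x, extM θ y, ⟨x, fun b hb => hu b (by simp [hb]), hx, rfl⟩,
        ⟨y, fun b hb => hu b (by simp [hb]), hy, rfl⟩, ?_⟩
      rw [wpow_add v k, wpow_add v (M * M * K + 1), List.append_assoc, extM_append,
        extM_append] at h2
      rcases infix_split h2 with h3 | h3
      · exact Or.inl h3
      · rcases infix_split h3 with h4 | h4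
        · exact absurd h4 (not_wpow_infix hv.1 (by have := hθl g hg; omega))
        · exact Or.inr h4
    -- Step 3: shapes
    have step3 : ∀ S : Set (List B), BigRep v S → (∀ s ∈ S, ∃ u, s = extM θ u ∧
        ∃ y p n z, u <:+: y ++ (wpow p n ++ z) ∧ y.length ≤ M * M ∧ z.length ≤ M * M ∧
          p.length ≤ M * M ∧ extM φ p = p) → v.length ≤ M * M * M := by
      intro S hS hall
      refine length_le_of_rep hv (BigRep.of_pad hv.1 (M * M * K) fun k => ?_)
      obtain ⟨s, hs, h1⟩ := hS k
      obtain ⟨u, rfl, y, p, n, z, h2, hy, hz, hp, hpp⟩ := hall s hs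
      have h3 := h1.trans (extM_infix θ h2)
      rw [extM_append, extM_append, extM_wpow] at h3
      refine ⟨_, _, _, h3, hθl y hy, hθl z hz, extM θ p, n, ?_, rfl⟩
      rw [hθx, Function.iterate_fixed hpp]
      exact (length_extM_le Ψ M p (fun a _ => hΨ a)).trans (Nat.mul_le_mul_right M hp)
    have triv : ∃ y p n z, ([] : List A) <:+: y ++ (wpow p n ++ z) ∧ y.length ≤ M * M ∧
        z.length ≤ M * M ∧ p.length ≤ M * M ∧ extM φ p = p :=
      ⟨[], [], 0, [], by simp, by simp, by simp, by simp, rfl⟩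
    rcases step2 with h2 | h2
    · refine step3 _ h2 ?_
      rintro s ⟨u, hu, rfl | ⟨c, m, hc⟩, rfl⟩
      · exact ⟨[], rfl, triv⟩
      · exact ⟨u, rfl, h.suffix_shape hM hφ c m u hu hc⟩
    · refine step3 _ h2 ?_
      rintro s ⟨u, hu, rfl | ⟨c, m, hc⟩, rfl⟩
      · exact ⟨[], rfl, triv⟩
      · exact ⟨u, rfl, h.prefix_shape hM hφ c m u hu hc⟩

end CoreSection

section Reductions

variable {A B : Type*}

lemma finite_of_power (φ : A → List A) (w : List A) (Ψ : A → List B) (N : ℕ) (hN : 0 < N)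
    (h : ∀ w' : List A, {v : List B | Primitive v ∧
      BigRep v (Set.range fun n => extM Ψ ((extM (iterM φ N))^[n] w'))}.Finite) :
    {v : List B | Primitive v ∧
      BigRep v (Set.range fun n => extM Ψ ((extM φ)^[n] w))}.Finite := by
  have hfin : (⋃ r : Fin N, {v : List B | Primitive v ∧
      BigRep v (Set.range fun n => extM Ψ ((extM (iterM φ N))^[n] ((extM φ)^[r.1] w)))}).Finite :=
    Set.finite_iUnion fun r => h _
  refine hfin.subset ?_
  rintro v ⟨hv, hrep⟩
  obtain ⟨r, hr⟩ := hrep.exists_of_iUnion (ι := Fin N)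
    (T := fun r => Set.range fun n => extM Ψ ((extM (iterM φ N))^[n] ((extM φ)^[r.1] w))) (by
      rintro s ⟨n, rfl⟩
      refine ⟨⟨n % N, Nat.mod_lt _ hN⟩, n / N, ?_⟩
      simp only
      rw [extM_iterM_fun, ← Function.iterate_mul, ← Function.iterate_add_apply, Nat.div_add_mod])
  exact Set.mem_iUnion.mpr ⟨r, hv, hr⟩

lemma exists_iter_idem {α : Type*} (f : α → α) (x : α) (h : (Set.range fun n => f^[n] x).Finite) :
    ∃ N, 0 < N ∧ ∀ k, 0 < k → f^[N * k] (f^[N * k] x) = f^[N * k] x := by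
  have hni : ¬ Function.Injective (fun n => f^[n] x) := fun hinj =>
    Set.infinite_range_of_injective hinj h
  obtain ⟨i, p, hp, hip⟩ : ∃ i p, 0 < p ∧ f^[i + p] x = f^[i] x := by
    simp only [Function.Injective, not_forall] at hni
    obtain ⟨a, b, hab, hne⟩ := hni
    rcases Nat.lt_or_gt_of_ne hne with hlt | hlt
    · exact ⟨a, b - a, by omega, by rw [Nat.add_sub_of_le hlt.le]; exact hab.symm⟩
    · exact ⟨b, a - b, by omega, by rw [Nat.add_sub_of_le hlt.le]; exact hab⟩
  have h1 : ∀ n, i ≤ n → f^[n + p] x = f^[n] x := by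
    intro n hn
    obtain ⟨m, rfl⟩ := Nat.exists_eq_add_of_le hn
    rw [show i + m + p = m + (i + p) by ring, Function.iterate_add_apply, hip,
      ← Function.iterate_add_apply, add_comm]
  have h2 : ∀ m n, i ≤ n → f^[n + p * m] x = f^[n] x := by
    intro m n hn
    induction m with
    | zero => rfl
    | succ m ih => rw [Nat.mul_succ, ← add_assoc, h1 _ (by omega), ih]
  refine ⟨p * (i + 1), by positivity, fun k hk => ?_⟩
  rw [← Function.iterate_add_apply, mul_assoc]
  refine h2 _ _ ?_
  have : i + 1 ≤ (i + 1) * k := Nat.le_mul_of_pos_right _ hk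
  have : (i + 1) * k ≤ p * ((i + 1) * k) := Nat.le_mul_of_pos_left _ hp
  omega

lemma exists_common {ι : Type*} [Fintype ι] (P : ι → ℕ → Prop)
    (h : ∀ i, ∃ N, 0 < N ∧ ∀ k, 0 < k → P i (N * k)) : ∃ N, 0 < N ∧ ∀ i, P i N := by
  choose N hN hP using h
  have hpos : 0 < ∏ i, N i := Finset.prod_pos fun i _ => hN i
  refine ⟨∏ i, N i, hpos, fun i => ?_⟩
  obtain ⟨k, hk⟩ := Finset.dvd_prod_of_mem N (Finset.mem_univ i)
  rw [hk]
  refine hP i k (Nat.pos_of_ne_zero ?_)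
  rintro rfl
  simp [hk] at hpos

lemma exists_last {U : A → Prop} {l : List A} (h : ∃ c ∈ l, U c) :
    ∃ x d y, l = x ++ d :: y ∧ U d ∧ Bd U y := by
  induction l with
  | nil => simp at h
  | cons a l ih =>
    by_cases hl : ∃ c ∈ l, U c
    · obtain ⟨x, d, y, h1, h2, h3⟩ := ih hl
      exact ⟨a :: x, d, y, by simp [h1], h2, h3⟩
    · refine ⟨[], a, l, rfl, ?_, fun b hb hU => hl ⟨b, hb, hU⟩⟩
      obtain ⟨c, hc, hU⟩ := h
      rcases List.mem_cons.mp hc with rfl | hc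
      · exact hU
      · exact absurd ⟨c, hc, hU⟩ hl

lemma exists_last_iter {φ : A → List A} {U : A → Prop} (h1 : ∀ b, ¬ U b → Bd U (φ b))
    (h2 : ∀ a, U a → ∃ c ∈ φ a, U c) :
    ∃ f : A → A, ∀ n a, U a → U (f^[n] a) ∧
      ∃ x y, (extM φ)^[n] [a] = x ++ f^[n] a :: y ∧ Bd U y := by
  have h3 : ∀ a, ∃ d, U a → ∃ x y, φ a = x ++ d :: y ∧ U d ∧ Bd U y := by
    intro a
    by_cases ha : U a
    · obtain ⟨x, d, y, h⟩ := exists_last (h2 a ha)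
      exact ⟨d, fun _ => ⟨x, y, h⟩⟩
    · exact ⟨a, fun h => absurd h ha⟩
  choose f hf using h3
  refine ⟨f, fun n a ha => ?_⟩
  induction n with
  | zero => exact ⟨ha, [], [], rfl, by simp [Bd]⟩
  | succ n ih =>
    obtain ⟨hU, x, y, h4, h5⟩ := ih
    obtain ⟨x', y', h6, h7, h8⟩ := hf _ hU
    rw [Function.iterate_succ_apply', Function.iterate_succ_apply']
    refine ⟨h7, extM φ x ++ x', y' ++ extM φ y, ?_, ?_⟩
    · rw [h4, extM_append, extM_cons, h6]; simp
    · intro b hb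
      rcases List.mem_append.mp hb with hb | hb
      · exact h8 b hb
      · obtain ⟨c, hc, hb⟩ := mem_extM.mp hb
        exact h1 c (h5 c hc) b hb

theorem nonerasing_finite [Fintype A] [Fintype B] (φ : A → List A) (hφ : NonErasing φ)
    (w : List A) (Ψ : A → List B) (hΨ : NonErasing Ψ) :
    {v : List B | Primitive v ∧
      BigRep v (Set.range fun n => extM Ψ ((extM φ)^[n] w))}.Finite := by
  classical
  set U : A → Prop := fun a => ¬ BddLetter φ a with hU
  have hb1 : ∀ b, ¬ U b → Bd U (φ b) := by
    intro b hb c hc hUc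
    refine hUc ?_
    obtain ⟨C, hC⟩ := not_not.mp hb
    refine ⟨C, fun n => ?_⟩
    have h1 := hC (n + 1)
    rw [Function.iterate_succ_apply, extM_single] at h1
    have : [c] <:+: φ b := by rwa [List.singleton_infix_iff]
    exact (iter_infix φ n this).length_le.trans h1
  have hu1 : ∀ a, U a → ∃ c ∈ φ a, U c := by
    intro a ha
    by_contra hcon
    have hall : ∀ c, ∃ C, c ∈ φ a → ∀ n, ((extM φ)^[n] [c]).length ≤ C := by
      intro c
      by_cases hc : c ∈ φ a
      · have : BddLetter φ c := by
          by_contra hn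
          exact hcon ⟨c, hc, hn⟩
        obtain ⟨C, hC⟩ := this
        exact ⟨C, fun _ => hC⟩
      · exact ⟨0, fun h => absurd h hc⟩
    choose C hC using hall
    refine ha ⟨1 + (φ a).length * ∑ c, C c, fun n => ?_⟩
    cases n with
    | zero => simp
    | succ n =>
      rw [Function.iterate_succ_apply, extM_single, ← extM_iterM]
      refine (length_extM_le _ (∑ c, C c) (φ a) ?_).trans (by omega)
      intro c hc
      exact (hC c hc n).trans (Finset.single_le_sum (f := C) (fun _ _ => Nat.zero_le _)
        (Finset.mem_univ c))
  obtain ⟨f, hf⟩ := exists_last_iter hb1 hu1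
  obtain ⟨g, hg⟩ := exists_last_iter (φ := revM φ) (U := U)
    (fun b hb c hc => hb1 b hb c (by simpa [revM] using hc))
    (fun a ha => by
      obtain ⟨c, hc, h⟩ := hu1 a ha
      exact ⟨c, by simpa [revM] using hc, h⟩)
  obtain ⟨N, hN, hP⟩ := exists_common (ι := A) (fun a N => f^[N] (f^[N] a) = f^[N] a ∧
      g^[N] (g^[N] a) = g^[N] a ∧
      (¬ U a → (extM φ)^[N] ((extM φ)^[N] [a]) = (extM φ)^[N] [a])) (by
    intro a
    obtain ⟨N1, hN1, h1⟩ := exists_iter_idem f a (Set.toFinite _)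
    obtain ⟨N2, hN2, h2⟩ := exists_iter_idem g a (Set.toFinite _)
    obtain ⟨N3, hN3, h3⟩ : ∃ N, 0 < N ∧ ∀ k, 0 < k → (¬ U a →
        (extM φ)^[N * k] ((extM φ)^[N * k] [a]) = (extM φ)^[N * k] [a]) := by
      by_cases ha : U a
      · exact ⟨1, one_pos, fun k _ h => absurd ha h⟩
      · obtain ⟨C, hC⟩ := not_not.mp ha
        obtain ⟨N, hN, h⟩ := exists_iter_idem (extM φ) [a] ((List.finite_length_le A C).subset (by
          rintro _ ⟨n, rfl⟩; exact hC n))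
        exact ⟨N, hN, fun k hk _ => h k hk⟩
    refine ⟨N1 * N2 * N3, by positivity, fun k hk => ⟨?_, ?_, ?_⟩⟩
    · rw [show N1 * N2 * N3 * k = N1 * (N2 * N3 * k) by ring]
      exact h1 _ (by positivity)
    · rw [show N1 * N2 * N3 * k = N2 * (N1 * N3 * k) by ring]
      exact h2 _ (by positivity)
    · rw [show N1 * N2 * N3 * k = N3 * (N1 * N2 * k) by ring]
      exact h3 _ (by positivity))
  refine finite_of_power φ w Ψ N hN fun w' => ?_
  have hcore : Core (iterM φ N) U := by
    refine ⟨?_, ?_, ?_, ?_⟩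
    · intro b hb
      have : ∀ n, Bd U ((extM φ)^[n] [b]) := by
        intro n
        induction n with
        | zero => intro c hc; simp at hc; rwa [hc]
        | succ n ih =>
          intro c hc
          rw [Function.iterate_succ_apply'] at hc
          obtain ⟨e, he, hc⟩ := mem_extM.mp hc
          exact hb1 e (ih e he) c hc
      exact this N
    · intro b hb
      rw [extM_iterM]
      exact (hP b).2.2 hb
    · intro a ha
      obtain ⟨h1, x, y, h2, h3⟩ := hf N a ha
      obtain ⟨-, x', y', h5, h6⟩ := hf N _ h1
      rw [(hP a).1] at h5
      exact ⟨x, f^[N] a, y, h2, h1, h3, x', y', h5, h6⟩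
    · intro a ha
      have hrev : ∀ c x d y, (extM (revM φ))^[N] [c] = x ++ d :: y →
          iterM φ N c = y.reverse ++ d :: x.reverse := by
        intro c x d y h
        have := iter_revM φ N [c]
        rw [List.reverse_singleton, h] at this
        unfold iterM
        rw [← List.reverse_reverse ((extM φ)^[N] [c]), ← this]
        simp
      obtain ⟨h1, x, y, h2, h3⟩ := hg N a ha
      obtain ⟨-, x', y', h5, h6⟩ := hg N _ h1
      rw [(hP a).2.1] at h5
      exact ⟨_, g^[N] a, _, hrev _ _ _ _ h2, h1, fun b hb => h3 b (by simpa using hb),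
        _, _, hrev _ _ _ _ h5, fun b hb => h6 b (by simpa using hb)⟩
  refine core_finite hcore w' Ψ ?_
  intro a ha C
  by_contra hcon
  push Not at hcon
  refine ha ⟨C, fun n => ?_⟩
  have h1 := hcon n
  rw [extM_iterM_fun, ← Function.iterate_mul] at h1
  have h2 := le_length_extM Ψ hΨ ((extM φ)^[N * n] [a])
  have h3 : ∀ m, ((extM φ)^[n] [a]).length ≤ ((extM φ)^[n + m] [a]).length := by
    intro m
    induction m with
    | zero => exact le_rfl
    | succ m ih =>
      refine ih.trans ?_
      rw [← add_assoc, Function.iterate_succ_apply']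
      exact le_length_extM φ hφ _
  obtain ⟨m, hm⟩ := Nat.exists_eq_add_of_le (Nat.le_mul_of_pos_left n hN)
  have h4 := h3 m
  rw [← hm] at h4
  omega

lemma BigRep.shift {v : List B} (hv : v ≠ []) {F : ℕ → List B} (h : BigRep v (Set.range F)) :
    BigRep v (Set.range fun n => F (n + 1)) := by
  intro k
  obtain ⟨_, ⟨n, rfl⟩, h1⟩ := h (k + ((F 0).length + 1))
  cases n with
  | zero => exact absurd h1 (not_wpow_infix hv (by omega))
  | succ n => exact ⟨_, ⟨n, rfl⟩, (wpow_infix_wpow v (by omega)).trans h1⟩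

theorem general_finite [Fintype A] [Fintype B] (φ : A → List A) (w : List A) (Ψ : A → List B) :
    {v : List B | Primitive v ∧
      BigRep v (Set.range fun n => extM Ψ ((extM φ)^[n] w))}.Finite := by
  classical
  set T : Set A → Set A := fun S => {b | ∀ c ∈ φ b, c ∈ S} with hT
  set E0 : Set A := {b | Ψ b = []} with hE0
  have key : ∀ n x, extM Ψ ((extM φ)^[n] x) = [] ↔ ∀ b ∈ x, b ∈ T^[n] E0 := by
    intro n
    induction n with
    | zero => intro x; simp [extM, hE0]
    | succ n ih =>
      intro x
      rw [Function.iterate_succ_apply, ih, Function.iterate_succ_apply']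
      constructor
      · intro h b hb c hc
        exact h c (mem_extM.mpr ⟨b, hb, hc⟩)
      · intro h c hc
        obtain ⟨b, hb, hc⟩ := mem_extM.mp hc
        exact h b hb c hc
  obtain ⟨N, hN, hid⟩ := exists_iter_idem T E0 (Set.toFinite _)
  have hid := hid 1 one_pos
  rw [mul_one] at hid
  set E := T^[N] E0 with hE
  have hmem1 : ∀ b, b ∈ E ↔ extM Ψ (iterM φ N b) = [] := by
    intro b
    unfold iterM
    rw [key]; simp [hE]
  have hmem2 : ∀ b, b ∈ E ↔ ∀ c ∈ iterM φ N b, c ∈ E := by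
    intro b
    rw [← key, iterM, ← Function.iterate_add_apply, key, Function.iterate_add_apply, ← hE, hid]
    simp
  refine finite_of_power φ w Ψ N hN fun w' => ?_
  set φN := iterM φ N with hφN
  set δ : A → List {a // a ∉ E} := fun a => if h : a ∈ E then [] else [⟨a, h⟩] with hδ
  have hδE : ∀ a ∈ E, δ a = [] := fun a ha => by simp [hδ, ha]
  have hδn : ∀ a (h : a ∉ E), δ a = [⟨a, h⟩] := fun a ha => by simp [hδ, ha]
  set φ' : {a // a ∉ E} → List {a // a ∉ E} := fun a => extM δ (φN a) with hφ'
  set Ψ' : {a // a ∉ E} → List B := fun a => extM Ψ (φN a) with hΨ'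
  have hc1 : ∀ x, extM δ (extM φN x) = extM φ' (extM δ x) := by
    intro x
    rw [extM_comp, extM_comp]
    congr 1
    funext a
    by_cases ha : a ∈ E
    · rw [hδE a ha, extM_nil]
      rw [List.eq_nil_iff_forall_not_mem]
      intro b hb
      obtain ⟨c, hc, hb⟩ := mem_extM.mp hb
      rw [hδE c ((hmem2 a).mp ha c hc)] at hb
      simp at hb
    · rw [hδn a ha, extM_single]
  have hc2 : ∀ x, extM Ψ (extM φN x) = extM Ψ' (extM δ x) := by
    intro x
    rw [extM_comp, extM_comp]
    congr 1
    funext a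
    by_cases ha : a ∈ E
    · rw [hδE a ha, extM_nil, (hmem1 a).mp ha]
    · rw [hδn a ha, extM_single]
  have hc3 : ∀ n x, extM δ ((extM φN)^[n] x) = (extM φ')^[n] (extM δ x) := by
    intro n
    induction n with
    | zero => intro x; rfl
    | succ n ih => intro x; rw [Function.iterate_succ_apply, ih, hc1, Function.iterate_succ_apply]
  have hφ'n : NonErasing φ' := by
    rintro ⟨a, ha⟩ h0
    refine ha ((hmem2 a).mpr fun c hc => ?_)
    by_contra hcE
    have : (⟨c, hcE⟩ : {a // a ∉ E}) ∈ extM δ (φN a) :=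
      mem_extM.mpr ⟨c, hc, by rw [hδn c hcE]; simp⟩
    have h0' : extM δ (φN a) = [] := h0
    rw [h0'] at this
    simp at this
  have hΨ'n : NonErasing Ψ' := by
    rintro ⟨a, ha⟩ h0
    exact ha ((hmem1 a).mpr h0)
  refine (nonerasing_finite φ' hφ'n (extM δ w') Ψ' hΨ'n).subset ?_
  rintro v ⟨hv, hrep⟩
  refine ⟨hv, ?_⟩
  have := hrep.shift hv.1
  have heq : (fun n => extM Ψ ((extM φN)^[n + 1] w')) =
      fun n => extM Ψ' ((extM φ')^[n] (extM δ w')) := by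
    funext n
    rw [Function.iterate_succ_apply', hc2, hc3]
  rw [heq] at this
  exact this

end Reductions

/-- For an HD0L-system `H = (A, φ, w, Ψ)` over finite alphabets with
non-erasing `φ`, the set of primitive words `v` such that `v^k ∈ L_H` for every `k`
is finite. -/
theorem stmt0 {A B : Type*} [Fintype A] [Fintype B]
    (φ : A → List A) (w : List A) (Ψ : A → List B) (hφ : NonErasing φ) :
    {v : List B | Primitive v ∧ ∀ k : ℕ, wpow v k ∈ LangHD0L φ w Ψ}.Finite := by
  refine (general_finite φ w Ψ).subset ?_
  rintro v ⟨hv, h⟩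
  refine ⟨hv, fun k => ?_⟩
  obtain ⟨u, ⟨n, hn⟩, hu⟩ := h k
  exact ⟨_, ⟨n, rfl⟩, hu.trans (extM_infix Ψ hn)⟩
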